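/- Let f be a continuous real function on [0, ∞) such that f(((A^(1/2) + B^(1/2))/2)^2) ≤ f((A + B)/2) (as Hermitian matrix inequality in the Loewner order) for all positive semidefinite n×n complex matrices A, B and all n. Then f is operator monotone on (0, ∞): for all Hermitian matrices X ≤ Y with positive definite X, f(X) ≤ f(Y). -/

import Mathlib

open scoped ComplexOrder

/-- The real power of a matrix, via the continuous functional calculus. -/
noncomputable def mpow {n : ℕ} (A : Matrix (Fin n) (Fin n) ℂ) (p : ℝ) :
    Matrix (Fin n) (Fin n) ℂ :=
  cfc (fun x : ℝ => x ^ p) A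

section helpers

open scoped MatrixOrder

theorem aux_mpow_sq {n : ℕ} (S : Matrix (Fin n) (Fin n) ℂ) (hS : 0 ≤ S) :
    mpow (S ^ 2) (1 / 2) = S := by
  have hsa : IsSelfAdjoint S := IsSelfAdjoint.of_nonneg hS
  unfold mpow
  have hc : ContinuousOn (fun x : ℝ => x ^ (1 / 2 : ℝ)) Set.univ :=
    (Real.continuous_rpow_const (by norm_num)).continuousOn
  rw [← cfc_comp_pow (fun x : ℝ => x ^ (1 / 2 : ℝ)) 2 S (hc.mono (Set.subset_univ _)) hsa]
  conv_rhs => rw [← cfc_id ℝ S hsa]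
  apply cfc_congr
  intro x hx
  have hx0 : 0 ≤ x := spectrum_nonneg_of_nonneg hS hx
  simp only [id]
  rw [← Real.sqrt_eq_rpow, Real.sqrt_sq hx0]

theorem aux_sqrt_sq {n : ℕ} (P : Matrix (Fin n) (Fin n) ℂ) (hP : 0 ≤ P) :
    cfc Real.sqrt P ^ 2 = P := by
  have hsa : IsSelfAdjoint P := IsSelfAdjoint.of_nonneg hP
  rw [← cfc_pow Real.sqrt 2 P Real.continuous_sqrt.continuousOn hsa]
  conv_rhs => rw [← cfc_id ℝ P hsa]
  apply cfc_congr
  intro x hx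
  have hx0 : 0 ≤ x := spectrum_nonneg_of_nonneg hP hx
  simp [Real.sq_sqrt hx0]

theorem aux_step (f : ℝ → ℝ)
    (h : ∀ (n : ℕ) (A B : Matrix (Fin n) (Fin n) ℂ), A.PosSemidef → B.PosSemidef →
      (cfc f ((2 : ℂ)⁻¹ • (A + B))
        - cfc f (((2 : ℂ)⁻¹ • (mpow A (1 / 2) + mpow B (1 / 2))) ^ 2)).PosSemidef)
    {n : ℕ} (X P : Matrix (Fin n) (Fin n) ℂ) (ε : ℝ) (hX0 : 0 ≤ X) (hP0 : 0 ≤ P)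
    (hX : algebraMap ℝ _ ε ≤ X) (hP : P ≤ algebraMap ℝ _ ε) :
    cfc f X ≤ cfc f (X + P) := by
  have hXs : IsSelfAdjoint X := IsSelfAdjoint.of_nonneg hX0
  have hPs : IsSelfAdjoint P := IsSelfAdjoint.of_nonneg hP0
  rw [algebraMap_le_iff_le_spectrum hXs] at hX
  rw [le_algebraMap_iff_spectrum_le hPs] at hP
  have hM2 := aux_sqrt_sq X hX0
  have hD2 := aux_sqrt_sq P hP0
  have hM : algebraMap ℝ _ (√ε) ≤ cfc Real.sqrt X :=
    algebraMap_le_cfc _ _ _ (fun x hx => Real.sqrt_le_sqrt (hX x hx))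
      Real.continuous_sqrt.continuousOn hXs
  have hD : cfc Real.sqrt P ≤ algebraMap ℝ _ (√ε) :=
    cfc_le_algebraMap _ _ _ (fun x hx => Real.sqrt_le_sqrt (hP x hx))
      Real.continuous_sqrt.continuousOn hPs
  have hM0 : 0 ≤ cfc Real.sqrt X := cfc_nonneg (fun x _ => Real.sqrt_nonneg x)
  have hD0 : 0 ≤ cfc Real.sqrt P := cfc_nonneg (fun x _ => Real.sqrt_nonneg x)
  generalize cfc Real.sqrt X = M at *
  generalize cfc Real.sqrt P = D at *
  have hS : 0 ≤ M + D := add_nonneg hM0 hD0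
  have hT : 0 ≤ M - D := sub_nonneg.2 (hD.trans hM)
  have sqpos : ∀ S : Matrix (Fin n) (Fin n) ℂ, 0 ≤ S → (S ^ 2).PosSemidef :=
    fun S hS => (Matrix.nonneg_iff_posSemidef.1 hS).pow 2
  have key := h n ((M + D) ^ 2) ((M - D) ^ 2) (sqpos _ hS) (sqpos _ hT)
  rw [aux_mpow_sq _ hS, aux_mpow_sq _ hT] at key
  have e1 : (2 : ℂ)⁻¹ • ((M + D) ^ 2 + (M - D) ^ 2) = X + P := by
    rw [← hM2, ← hD2]
    have : (M + D) ^ 2 + (M - D) ^ 2 = (2 : ℂ) • (M ^ 2 + D ^ 2) := by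
      rw [two_smul]; noncomm_ring
    rw [this, smul_smul]; norm_num
  have e2 : (2 : ℂ)⁻¹ • ((M + D) + (M - D)) = M := by
    have : (M + D) + (M - D) = (2 : ℂ) • M := by
      rw [two_smul]; abel
    rw [this, smul_smul]; norm_num
  rw [e1, e2, hM2] at key
  exact key

theorem aux_main (f : ℝ → ℝ)
    (h : ∀ (n : ℕ) (A B : Matrix (Fin n) (Fin n) ℂ), A.PosSemidef → B.PosSemidef →
      (cfc f ((2 : ℂ)⁻¹ • (A + B))
        - cfc f (((2 : ℂ)⁻¹ • (mpow A (1 / 2) + mpow B (1 / 2))) ^ 2)).PosSemidef)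
    {n : ℕ} (X Y : Matrix (Fin n) (Fin n) ℂ) (hX : X.PosDef) (hXY : X ≤ Y) :
    cfc f X ≤ cfc f Y := by
  have hX0 : 0 ≤ X := Matrix.nonneg_iff_posSemidef.2 hX.posSemidef
  have hP0 : 0 ≤ Y - X := sub_nonneg.2 hXY
  have hPs : (Y - X).IsHermitian := IsSelfAdjoint.of_nonneg hP0
  obtain ⟨ε, hε, hεX⟩ : ∃ ε : ℝ, 0 < ε ∧ algebraMap ℝ _ ε ≤ X := by
    obtain ⟨K, hK⟩ := (Set.finite_range fun i => (hX.1.eigenvalues i)⁻¹).bddAbove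
    refine ⟨(|K| + 1)⁻¹, by positivity, ?_⟩
    rw [algebraMap_le_iff_le_spectrum (show IsSelfAdjoint X from hX.1)]
    intro x hx
    rw [hX.1.spectrum_real_eq_range_eigenvalues] at hx
    obtain ⟨i, rfl⟩ := hx
    have h1 : (hX.1.eigenvalues i)⁻¹ ≤ K := hK ⟨i, rfl⟩
    have h2 := hX.eigenvalues_pos i
    apply inv_le_of_inv_le₀ h2
    linarith [le_abs_self K]
  obtain ⟨K, hK⟩ : ∃ K : ℝ, ∀ x ∈ spectrum ℝ (Y - X), x ≤ K := by
    rw [hPs.spectrum_real_eq_range_eigenvalues]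
    obtain ⟨K, hK⟩ := (Set.finite_range hPs.eigenvalues).bddAbove
    exact ⟨K, fun x hx => hK hx⟩
  have hK' : Y - X ≤ algebraMap ℝ _ K := le_algebraMap_of_spectrum_le hK hPs
  obtain ⟨N, hN⟩ := exists_nat_gt (|K| / ε)
  have hN0 : (0 : ℝ) < N := lt_of_le_of_lt (by positivity) hN
  have hKN : (N : ℝ)⁻¹ * K ≤ ε := by
    rw [div_lt_iff₀ hε] at hN
    rw [inv_mul_le_iff₀ hN0]
    linarith [le_abs_self K]
  obtain ⟨Q, hQ⟩ : ∃ Q, Q = (N : ℝ)⁻¹ • (Y - X) := ⟨_, rfl⟩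
  have hQ0 : 0 ≤ Q := by
    rw [hQ]; exact smul_nonneg (by positivity) hP0
  have hQε : Q ≤ algebraMap ℝ _ ε := by
    have h1 : Q ≤ (N : ℝ)⁻¹ • algebraMap ℝ _ K := by
      rw [hQ]; exact smul_le_smul_of_nonneg_left hK' (by positivity)
    refine h1.trans ?_
    rw [Algebra.algebraMap_eq_smul_one K, smul_smul, ← Algebra.algebraMap_eq_smul_one]
    exact algebraMap_mono _ hKN
  have hind : ∀ k : ℕ, cfc f X ≤ cfc f (X + k • Q) := by
    intro k
    induction k with
    | zero => simp
    | succ k ih =>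
      refine ih.trans ?_
      have hk : 0 ≤ k • Q := nsmul_nonneg hQ0 k
      rw [succ_nsmul, ← add_assoc]
      exact aux_step f h _ Q ε (add_nonneg hX0 hk) hQ0
        (hεX.trans (le_add_of_nonneg_right hk)) hQε
  have hfin := hind N
  have : X + N • Q = Y := by
    rw [hQ, ← Nat.cast_smul_eq_nsmul ℝ, smul_smul, mul_inv_cancel₀ hN0.ne', one_smul]
    abel
  rwa [this] at hfin

end helpers

theorem operator_monotone_of_sqrt_mean_ineq (f : ℝ → ℝ)
    (hf : ContinuousOn f (Set.Ici 0))
    (h : ∀ (n : ℕ) (A B : Matrix (Fin n) (Fin n) ℂ), A.PosSemidef → B.PosSemidef →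
      (cfc f ((2 : ℂ)⁻¹ • (A + B))
        - cfc f (((2 : ℂ)⁻¹ • (mpow A (1 / 2) + mpow B (1 / 2))) ^ 2)).PosSemidef) :
    ∀ (n : ℕ) (X Y : Matrix (Fin n) (Fin n) ℂ), X.PosDef → Y.IsHermitian →
      (Y - X).PosSemidef → (cfc f Y - cfc f X).PosSemidef := by
  intro n X Y hX _ hXY
  exact aux_main f h X Y hX hXY
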